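/- Let n ≥ 2. For a smooth symmetric matrix field Ω : ℝⁿ → Matₙ(ℝ), define the linearized Ricci operator (Ric Ω)ᵢⱼ = (1/2)·∑ᵣ(∂ᵣ∂ᵢΩᵣⱼ + ∂ᵣ∂ⱼΩᵣᵢ - ∂ᵣ∂ᵣΩᵢⱼ) - (1/2)·∂ᵢ∂ⱼ(∑ᵣΩᵣᵣ). Then Ric is NOT formally self-adjoint: there exist compactly supported smooth symmetric fields Ω, Ω' : ℝⁿ → Matₙ(ℝ) such that ∑_{i,j} ∫_{ℝⁿ} (Ric Ω)ᵢⱼ·Ω'ᵢⱼ dx ≠ ∑_{i,j} ∫_{ℝⁿ} Ωᵢⱼ·(Ric Ω')ᵢⱼ dx. -/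

import Mathlib

open MeasureTheory

/-- Partial derivative in the `i`-th coordinate direction on `ℝⁿ`. -/
noncomputable def pd {n : ℕ} (i : Fin n)
    (f : EuclideanSpace ℝ (Fin n) → ℝ) (x : EuclideanSpace ℝ (Fin n)) : ℝ :=
  fderiv ℝ f x (EuclideanSpace.single i 1)

/-- The linearized Ricci operator at the flat Euclidean metric. -/
noncomputable def linRicci {n : ℕ}
    (Ω : EuclideanSpace ℝ (Fin n) → Fin n → Fin n → ℝ)
    (x : EuclideanSpace ℝ (Fin n)) (i j : Fin n) : ℝ :=
  (1 / 2) * ∑ r : Fin n,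
      (pd r (pd i (fun y => Ω y r j)) x + pd r (pd j (fun y => Ω y r i)) x
        - pd r (pd r (fun y => Ω y i j)) x)
    - (1 / 2) * pd i (pd j (fun y => ∑ r : Fin n, Ω y r r)) x

lemma contDiff_pd {n : ℕ} (i : Fin n) {f : EuclideanSpace ℝ (Fin n) → ℝ}
    (hf : ContDiff ℝ (⊤ : ℕ∞) f) : ContDiff ℝ (⊤ : ℕ∞) (pd i f) :=
  (hf.fderiv_right (m := (⊤ : ℕ∞)) (by simp)).clm_apply contDiff_const

lemma pd_mul_const {n : ℕ} (i : Fin n) {f : EuclideanSpace ℝ (Fin n) → ℝ}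
    (hf : ContDiff ℝ (⊤ : ℕ∞) f) (c : ℝ) :
    pd i (fun y => f y * c) = fun y => pd i f y * c := by
  ext x
  rw [pd, fderiv_mul_const (hf.differentiable (by simp) x)]
  simp [pd, mul_comm]

lemma pd_comm {n : ℕ} (i j : Fin n) {f : EuclideanSpace ℝ (Fin n) → ℝ}
    (hf : ContDiff ℝ (⊤ : ℕ∞) f) : pd i (pd j f) = pd j (pd i f) := by
  have hd : Differentiable ℝ (fderiv ℝ f) :=
    (hf.fderiv_right (m := (⊤ : ℕ∞)) (by simp)).differentiable (by simp)
  have key (k l : Fin n) (x) : pd k (pd l f) x =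
      fderiv ℝ (fderiv ℝ f) x (EuclideanSpace.single k 1) (EuclideanSpace.single l 1) := by
    unfold pd
    rw [fderiv_clm_apply (hd x) (differentiableAt_const _)]
    simp
  ext x
  rw [key, key]
  exact (hf.contDiffAt.isSymmSndFDerivAt (by simpa using WithTop.coe_le_coe.2 (le_top : (2 : ℕ∞) ≤ ⊤))) _ _

lemma linRicci_mul_const {n : ℕ} {f : EuclideanSpace ℝ (Fin n) → ℝ}
    (hf : ContDiff ℝ (⊤ : ℕ∞) f) (A : Fin n → Fin n → ℝ)
    (x : EuclideanSpace ℝ (Fin n)) (i j : Fin n) :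
    linRicci (fun y k l => f y * A k l) x i j =
      (1 / 2) * ∑ r, (pd r (pd i f) x * A r j + pd r (pd j f) x * A r i
        - pd r (pd r f) x * A i j) - (1 / 2) * (pd i (pd j f) x * ∑ r, A r r) := by
  simp only [linRicci, ← Finset.mul_sum, pd_mul_const _ hf, pd_mul_const _ (contDiff_pd _ hf)]

lemma contDiff_mul_const_field {n : ℕ} {f : EuclideanSpace ℝ (Fin n) → ℝ}
    (hf : ContDiff ℝ (⊤ : ℕ∞) f) (A : Fin n → Fin n → ℝ) :
    ContDiff ℝ (⊤ : ℕ∞) (fun y k l => f y * A k l) :=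
  contDiff_pi' fun _ => contDiff_pi' fun _ => hf.mul contDiff_const

lemma hasCompactSupport_mul_const_field {n : ℕ} {f : EuclideanSpace ℝ (Fin n) → ℝ}
    (hf : HasCompactSupport f) (A : Fin n → Fin n → ℝ) :
    HasCompactSupport (fun y k l => f y * A k l) :=
  hf.comp_left (g := fun t k l => t * A k l) (by ext; simp)

lemma hasCompactSupport_pd {n : ℕ} (i : Fin n) {f : EuclideanSpace ℝ (Fin n) → ℝ}
    (hf : HasCompactSupport f) : HasCompactSupport (pd i f) :=
  (hf.fderiv ℝ).comp_left
    (g := fun L : EuclideanSpace ℝ (Fin n) →L[ℝ] ℝ => L (EuclideanSpace.single i 1)) (by simp)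

/-- A compactly supported smooth function equal to `x p * x q` near the origin. -/
lemma exists_pd_pd_ne_zero {n : ℕ} {p q : Fin n} (hpq : p ≠ q) :
    ∃ g : EuclideanSpace ℝ (Fin n) → ℝ, ContDiff ℝ (⊤ : ℕ∞) g ∧ HasCompactSupport g ∧
      pd q (pd p g) 0 ≠ 0 := by
  let χ : ContDiffBump (0 : EuclideanSpace ℝ (Fin n)) := ⟨1, 2, one_pos, one_lt_two⟩
  have hcoord (k : Fin n) (y : EuclideanSpace ℝ (Fin n)) :
      HasFDerivAt (fun x : EuclideanSpace ℝ (Fin n) => x k)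
        (EuclideanSpace.proj k : EuclideanSpace ℝ (Fin n) →L[ℝ] ℝ) y :=
    (EuclideanSpace.proj k : EuclideanSpace ℝ (Fin n) →L[ℝ] ℝ).hasFDerivAt
  have hsmooth (k : Fin n) : ContDiff ℝ (⊤ : ℕ∞) (fun x : EuclideanSpace ℝ (Fin n) => x k) :=
    (EuclideanSpace.proj k : EuclideanSpace ℝ (Fin n) →L[ℝ] ℝ).contDiff
  refine ⟨fun x => χ x * (x p * x q), χ.contDiff.mul ((hsmooth p).mul (hsmooth q)),
    χ.hasCompactSupport.mul_right, ?_⟩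
  have hloc : (fun x => χ x * (x p * x q)) =ᶠ[nhds 0] fun x => x p * x q := by
    filter_upwards [χ.eventuallyEq_one] with x hx
    simp [hx]
  have hpd : pd p (fun x => χ x * (x p * x q)) =ᶠ[nhds 0] fun x => x q := by
    filter_upwards [hloc.fderiv (𝕜 := ℝ)] with x hx
    rw [pd, hx, HasFDerivAt.fderiv (f := fun x : EuclideanSpace ℝ (Fin n) => x p * x q)
      ((hcoord p x).mul (hcoord q x))]
    simp [hpq.symm]
  rw [pd, hpd.fderiv_eq, (hcoord q 0).fderiv]
  simp

/-- The linearized Ricci operator is not formally self-adjoint. -/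
theorem linRicci_not_self_adjoint (n : ℕ) (hn : 2 ≤ n) :
    ∃ Ω Ω' : EuclideanSpace ℝ (Fin n) → Fin n → Fin n → ℝ,
      ContDiff ℝ (⊤ : ℕ∞) Ω ∧ HasCompactSupport Ω ∧ (∀ x i j, Ω x i j = Ω x j i) ∧
      ContDiff ℝ (⊤ : ℕ∞) Ω' ∧ HasCompactSupport Ω' ∧ (∀ x i j, Ω' x i j = Ω' x j i) ∧
      ∑ i : Fin n, ∑ j : Fin n, ∫ x, linRicci Ω x i j * Ω' x i j ≠
        ∑ i : Fin n, ∑ j : Fin n, ∫ x, Ω x i j * linRicci Ω' x i j := by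
  obtain ⟨p, q, hpq⟩ : ∃ p q : Fin n, p ≠ q := ⟨⟨0, by omega⟩, ⟨1, by omega⟩, by simp⟩
  obtain ⟨g, hg, hgc, hg0⟩ := exists_pd_pd_ne_zero hpq
  set f := pd q (pd p g) with hfdef
  have hf : ContDiff ℝ (⊤ : ℕ∞) f := contDiff_pd _ (contDiff_pd _ hg)
  have hfc : HasCompactSupport f := hasCompactSupport_pd q (hasCompactSupport_pd p hgc)
  let A : Fin n → Fin n → ℝ := fun i j => if i = p then if j = p then 1 else 0 else 0
  let B : Fin n → Fin n → ℝ := fun i j =>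
    (if i = p then if j = q then 1 else 0 else 0) + (if i = q then if j = p then 1 else 0 else 0)
  refine ⟨fun y k l => f y * A k l, fun y k l => g y * B k l,
    contDiff_mul_const_field hf A, hasCompactSupport_mul_const_field hfc A, ?_,
    contDiff_mul_const_field hg B, hasCompactSupport_mul_const_field hgc B, ?_, ?_⟩
  · intro x i j
    simp only [A]
    split_ifs <;> rfl
  · intro x i j
    simp only [B]
    split_ifs <;> simp
  have hleft (i j : Fin n) (x) :
      linRicci (fun y k l => f y * A k l) x i j * (g x * B i j) = 0 := by
    rw [linRicci_mul_const hf]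
    by_cases h₁ : i = p ∧ j = q
    · obtain ⟨rfl, rfl⟩ := h₁
      simp [A, hpq.symm]
    by_cases h₂ : i = q ∧ j = p
    · obtain ⟨rfl, rfl⟩ := h₂
      simp [A, hpq.symm, pd_comm i j hf]
    have hB : B i j = 0 := by
      simp only [B]
      split_ifs <;> simp_all
    simp [hB]
  have hright (i j : Fin n) (x) :
      f x * A i j * linRicci (fun y k l => g y * B k l) x i j =
        if i = p then if j = p then f x ^ 2 else 0 else 0 := by
    rw [linRicci_mul_const hg]
    by_cases hi : i = p
    · by_cases hj : j = p
      · subst hi hj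
        simp [A, B, hpq, hpq.symm, Finset.sum_add_distrib, ← hfdef]
        ring
      · simp [A, hj]
    · simp [A, hi]
  have hpos : 0 < ∫ x, f x ^ 2 := by
    refine Continuous.integral_pos_of_hasCompactSupport_nonneg_nonzero (x := 0)
      (hf.continuous.pow 2) ?_ (fun x => sq_nonneg _) (pow_ne_zero 2 hg0)
    exact hfc.comp_left (g := fun t => t ^ 2) (by simp)
  have hsum : ∑ i, ∑ j, ∫ x, f x * A i j * linRicci (fun y k l => g y * B k l) x i j =
      ∫ x, f x ^ 2 := by
    simp_rw [hright]
    rw [Finset.sum_eq_single_of_mem p (Finset.mem_univ _) (by simp +contextual),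
      Finset.sum_eq_single_of_mem p (Finset.mem_univ _) (by simp +contextual)]
    simp
  simp only [hleft]
  rw [hsum]
  simpa using hpos.ne
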